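/- For an odd natural number n, the sesquilinear form ⟨f,h⟩ = i^n ∫_ℝ conj(f^{(n)}(t)) h(t) dt on S(ℝ) is indefinite: there exist Schwartz functions f and g with ⟨f,f⟩ > 0 and ⟨g,g⟩ < 0. -/

import Mathlib

open MeasureTheory Complex
open scoped ComplexConjugate ComplexOrder

/-- The sesquilinear form `⟨f,h⟩ = iⁿ ∫ conj(f⁽ⁿ⁾(t)) h(t) dt` on Schwartz space. -/
noncomputable def derivForm (n : ℕ) (f h : SchwartzMap ℝ ℂ) : ℂ :=
  I ^ n * ∫ t : ℝ, conj (iteratedDeriv n (⇑f) t) * h t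

open scoped FourierTransform SchwartzMap

lemma SchwartzMap.coe_iterate_derivCLM (n : ℕ) (f : 𝓢(ℝ, ℂ)) :
    ⇑((derivCLM ℂ ℂ)^[n] f) = iteratedDeriv n f := by
  induction n with
  | zero => simp
  | succ n ih =>
    ext x
    rw [Function.iterate_succ_apply', derivCLM_apply, ih, iteratedDeriv_succ]

/-- On the Fourier side the form is the weighted `L²` form with weight `(2πξ)ⁿ`. -/
lemma derivForm_self_eq_integral_fourier (n : ℕ) (f : 𝓢(ℝ, ℂ)) :
    derivForm n f f = ((∫ ξ : ℝ, (2 * Real.pi * ξ) ^ n * ‖(𝓕 f) ξ‖ ^ 2 : ℝ) : ℂ) := by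
  set D := (SchwartzMap.derivCLM ℂ ℂ)^[n] f with hD
  have hF : ∀ ξ : ℝ, (𝓕 D) ξ = (2 * Real.pi * I * ξ) ^ n * (𝓕 f) ξ := by
    intro ξ
    have h := Real.fourier_iteratedDeriv (f := f) (N := ⊤) (n := n) (f.smooth ⊤)
      (fun k _ ↦ by
        rw [← SchwartzMap.coe_iterate_derivCLM]
        exact SchwartzMap.integrable _) le_top
    rw [SchwartzMap.fourier_coe, SchwartzMap.fourier_coe, hD, SchwartzMap.coe_iterate_derivCLM, h]
    rfl
  have hP : ∫ t : ℝ, conj (iteratedDeriv n f t) * f t = ∫ ξ : ℝ, conj ((𝓕 D) ξ) * (𝓕 f) ξ := by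
    have h := SchwartzMap.integral_inner_fourier_fourier D f
    simp only [RCLike.inner_apply'] at h
    rw [h, hD, SchwartzMap.coe_iterate_derivCLM]
  rw [derivForm, hP, ← integral_const_mul, ← integral_complex_ofReal]
  congr with ξ
  have hI : I ^ n * conj ((2 * Real.pi * I * ξ : ℂ) ^ n) = (2 * Real.pi * ξ : ℂ) ^ n := by
    rw [map_pow, ← mul_pow]
    congr 1
    simp only [map_mul, conj_I, conj_ofReal, map_ofNat]
    linear_combination (-2 * Real.pi * ξ : ℂ) * I_mul_I
  rw [hF, map_mul, mul_assoc, ← mul_assoc, hI, conj_mul']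
  push_cast
  rfl

/-- The form takes values of the sign of `cⁿ` for every nonzero `c`. -/
lemma exists_pow_mul_derivForm_self_pos (n : ℕ) {c : ℝ} (hc : c ≠ 0) :
    ∃ f : 𝓢(ℝ, ℂ), 0 < (c : ℂ) ^ n * derivForm n f f := by
  have hc' : 0 < |c| := abs_pos.mpr hc
  let b : ContDiffBump c := ⟨|c| / 4, |c| / 2, by positivity, by linarith⟩
  have hsupp : HasCompactSupport (fun x ↦ (b x : ℂ)) := b.hasCompactSupport.comp_left ofReal_zero
  let φ : 𝓢(ℝ, ℂ) := hsupp.toSchwartzMap (ofRealCLM.contDiff.comp b.contDiff)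
  have hφ : ∀ x, φ x = b x := fun x ↦ rfl
  refine ⟨𝓕⁻ φ, ?_⟩
  rw [derivForm_self_eq_integral_fourier, FourierTransform.fourier_fourierInv_eq, ← ofReal_pow,
    ← ofReal_mul, ← integral_const_mul, ← ofReal_zero, real_lt_real]
  simp only [hφ, norm_real, Real.norm_eq_abs, sq_abs, ← mul_assoc, ← mul_pow]
  refine Continuous.integral_pos_of_hasCompactSupport_nonneg_nonzero (x := c)
    (by have := b.continuous; fun_prop) ?_ (fun x ↦ ?_) ?_
  · refine HasCompactSupport.mul_left ?_
    exact b.hasCompactSupport.comp_left (g := fun y ↦ y ^ 2) (by simp)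
  · by_cases hx : x ∈ Metric.ball c (|c| / 2)
    · have h : 0 ≤ c * x := by
        rw [Metric.mem_ball, Real.dist_eq] at hx
        have := abs_mul c (x - c)
        nlinarith [neg_abs_le (c * (x - c)), sq_abs c]
      have : 0 ≤ c * 2 * Real.pi * x := by
        rw [mul_right_comm, mul_right_comm c]
        positivity
      exact mul_nonneg (pow_nonneg this n) (sq_nonneg _)
    · have : b x = 0 := by
        rw [← Function.notMem_support, b.support_eq]; exact hx
      simp [this]
  · have : b c = 1 := b.one_of_mem_closedBall (Metric.mem_closedBall_self b.rIn_pos.le)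
    simp [this, hc, Real.pi_ne_zero]

/-- for odd `n`, the form `⟨f,h⟩ = iⁿ ∫ conj(f⁽ⁿ⁾(t)) h(t) dt` is
indefinite: there are Schwartz functions `f, g` with `⟨f,f⟩ > 0` and `⟨g,g⟩ < 0`. -/
theorem stmt_8 (n : ℕ) (hn : Odd n) :
    ∃ f g : SchwartzMap ℝ ℂ, 0 < derivForm n f f ∧ derivForm n g g < 0 := by
  obtain ⟨f, hf⟩ := exists_pow_mul_derivForm_self_pos n one_ne_zero
  obtain ⟨g, hg⟩ := exists_pow_mul_derivForm_self_pos n (neg_ne_zero.mpr one_ne_zero)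
  exact ⟨f, g, by simpa using hf, by simpa [hn.neg_one_pow] using hg⟩
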